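/- For every even integer n ≥ 3×10^6, we have φ(n) − 2 − 2·π(n) > 1000; in particular φ(n) > 2 + 2·π(n), where φ is Euler's totient function and π is the prime-counting function. -/

import Mathlib

open Finset

theorem Nat.multinomial_mul_prod_pow_le {ι : Type*} [DecidableEq ι] (s : Finset ι) (k : ι → ℕ)
    (hk : ∀ i ∉ s, k i = 0) (x : ι → ℕ) :
    Nat.multinomial s k * ∏ i ∈ s, x i ^ k i ≤ (∑ i ∈ s, x i) ^ ∑ i ∈ s, k i := by
  rw [Finset.sum_pow_eq_sum_piAntidiag]
  refine Finset.single_le_sum (f := fun k : ι → ℕ ↦ Nat.multinomial s k * ∏ i ∈ s, x i ^ k i)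
    (fun _ _ ↦ Nat.zero_le _) (Finset.mem_piAntidiag.2 ⟨rfl, fun i hi ↦ ?_⟩)
  by_contra h
  exact hi (hk i h)

/-- The parts of the multinomial coefficient `(42 n)! / ((21 n)! (14 n)! (6 n)! n!)`. -/
def sylvesterParts (n : ℕ) : Fin 4 → ℕ := ![21 * n, 14 * n, 6 * n, n]

theorem sylvester_multinomial_spec (n : ℕ) :
    (21 * n).factorial * (14 * n).factorial * (6 * n).factorial * n.factorial *
      Nat.multinomial univ (sylvesterParts n) = (42 * n).factorial := by
  have h := Nat.multinomial_spec univ (sylvesterParts n)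
  simp only [Fin.prod_univ_four, Fin.sum_univ_four] at h
  simp only [sylvesterParts, Matrix.cons_val] at h ⊢
  rw [h]
  congr 1
  ring

theorem sylvester_multinomial_le (n : ℕ) :
    Nat.multinomial univ (sylvesterParts n) ≤ (2 ^ 22 * 3 ^ 15 * 7 ^ 7) ^ n := by
  have h := Nat.multinomial_mul_prod_pow_le univ (sylvesterParts n) (by simp) ![21, 14, 6, 1]
  simp only [Fin.prod_univ_four, Fin.sum_univ_four] at h
  simp only [sylvesterParts, Matrix.cons_val] at h ⊢
  have e : 21 * n + 14 * n + 6 * n + n = 42 * n := by ring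
  rw [e, pow_mul, pow_mul, pow_mul, pow_mul, one_pow, mul_one, ← mul_pow, ← mul_pow] at h
  refine le_of_mul_le_mul_right (h.trans_eq ?_)
    (show 0 < (21 ^ 21 * 14 ^ 14 * 6 ^ 6) ^ n by positivity)
  rw [← mul_pow]
  norm_num

theorem prime_dvd_sylvester_multinomial {n p : ℕ} (hp : p.Prime) (h1 : n < p) (h2 : p ≤ 42 * n) :
    p ∣ Nat.multinomial univ (sylvesterParts n) := by
  set M := Nat.multinomial univ (sylvesterParts n) with hM
  have hM0 : M ≠ 0 := (Nat.multinomial_pos _ _).ne'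
  have hs := congrArg (fun m ↦ m.factorization p) (sylvester_multinomial_spec n)
  simp only [← hM] at hs
  have hb : ∀ m ≤ 42 * n, Nat.log p m < Nat.log p (42 * n) + 1 := fun m hm ↦
    Nat.lt_succ_of_le (Nat.log_mono_right hm)
  rw [Nat.factorization_mul (by positivity) hM0, Nat.factorization_mul (by positivity)
    (by positivity), Nat.factorization_mul (by positivity) (by positivity),
    Nat.factorization_mul (by positivity) (by positivity)] at hs
  simp only [Finsupp.add_apply] at hs
  rw [Nat.factorization_factorial hp (hb _ (by lia)), Nat.factorization_factorial hp
    (hb _ (by lia)), Nat.factorization_factorial hp (hb _ (by lia)),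
    Nat.factorization_factorial hp (hb n (by lia)), Nat.factorization_factorial hp
    (hb _ le_rfl), ← sum_add_distrib, ← sum_add_distrib, ← sum_add_distrib] at hs
  have hlog : 1 ≤ Nat.log p (42 * n) := Nat.log_pos hp.one_lt h2
  have hlt : ∑ i ∈ Ico 1 (Nat.log p (42 * n) + 1),
      (21 * n / p ^ i + 14 * n / p ^ i + 6 * n / p ^ i + n / p ^ i) <
      ∑ i ∈ Ico 1 (Nat.log p (42 * n) + 1), 42 * n / p ^ i := by
    refine sum_lt_sum (fun i _ ↦ ?_) ⟨1, by simp; lia, ?_⟩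
    · rw [show 42 * n = 21 * n + 14 * n + 6 * n + n by ring]
      have h2 := Nat.div_add_div_le_add_div (x := 21 * n) (y := 14 * n) (z := p ^ i)
      have h3 := Nat.div_add_div_le_add_div (x := 21 * n + 14 * n) (y := 6 * n) (z := p ^ i)
      have h4 := Nat.div_add_div_le_add_div (x := 21 * n + 14 * n + 6 * n) (y := n) (z := p ^ i)
      lia
    · rw [pow_one]
      have h0 : n / p = 0 := Nat.div_eq_of_lt h1
      have ha : 1 ≤ 42 * n / p := (Nat.one_le_div_iff hp.pos).2 h2
      have e2 : 21 * n / p = 42 * n / p / 2 := by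
        rw [Nat.div_div_eq_div_mul, show 42 * n = 21 * n * 2 by ring,
          Nat.mul_div_mul_right _ _ two_pos]
      have e3 : 14 * n / p = 42 * n / p / 3 := by
        rw [Nat.div_div_eq_div_mul, show 42 * n = 14 * n * 3 by ring,
          Nat.mul_div_mul_right _ _ three_pos]
      have e7 : 6 * n / p = 42 * n / p / 7 := by
        rw [Nat.div_div_eq_div_mul, show 42 * n = 6 * n * 7 by ring,
          Nat.mul_div_mul_right _ _ (by norm_num)]
      have e42 : n / p = 42 * n / p / 42 := by
        rw [Nat.div_div_eq_div_mul, show 42 * n = n * 42 by ring,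
          Nat.mul_div_mul_right _ _ (by norm_num)]
      rw [e2, e3, e7, h0]
      rw [h0] at e42
      lia
  exact Nat.dvd_of_factorization_pos (by lia)

theorem primorial_mul_dvd (n : ℕ) :
    primorial (42 * n) ∣ primorial n * Nat.multinomial univ (sylvesterParts n) := by
  rw [show 42 * n = n + 41 * n by ring, primorial_add]
  refine mul_dvd_mul_left _ (prod_primes_dvd _ (fun _ hk ↦ (mem_filter.1 hk).2.prime)
    fun p hp ↦ ?_)
  rw [mem_filter, mem_Ico] at hp
  exact prime_dvd_sylvester_multinomial hp.2 (by lia) (by lia)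

theorem theta_mul_le (n : ℕ) :
    Chebyshev.theta ((42 * n : ℕ) : ℝ) ≤ Chebyshev.theta n + 45.401141 * n := by
  rw [Chebyshev.theta_eq_log_primorial, Chebyshev.theta_eq_log_primorial, Nat.floor_natCast,
    Nat.floor_natCast]
  have h := (Nat.le_of_dvd (Nat.mul_pos (primorial_pos n) (Nat.multinomial_pos _ _))
    (primorial_mul_dvd n)).trans (Nat.mul_le_mul_left _ (sylvester_multinomial_le n))
  have hn := primorial_pos n
  have h' : Real.log (primorial (42 * n)) ≤
      Real.log ((primorial n : ℝ) * (2 ^ 22 * 3 ^ 15 * 7 ^ 7) ^ n) :=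
    Real.log_le_log (by exact_mod_cast primorial_pos _) (by exact_mod_cast h)
  rw [Real.log_mul (by positivity) (by positivity), Real.log_pow] at h'
  have hc : Real.log (2 ^ 22 * 3 ^ 15 * 7 ^ 7) ≤ 45.401141 := by
    have h1 : Real.log ((2 ^ 22 * 3 ^ 15 * 7 ^ 7) ^ 2) ≤ Real.log (2 ^ 131) :=
      Real.log_le_log (by positivity) (by norm_num)
    rw [Real.log_pow, Real.log_pow] at h1
    have := Real.log_two_lt_d9
    norm_num at h1 ⊢
    linarith
  have h3 := mul_le_mul_of_nonneg_left hc (Nat.cast_nonneg (α := ℝ) n)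
  rw [mul_comm (n : ℝ) 45.401141] at h3
  exact h'.trans (add_le_add_right h3 _)

theorem theta_le_linear (n : ℕ) : Chebyshev.theta n ≤ 1.12 * n + 1010 := by
  induction n using Nat.strong_induction_on with | _ n ih
  rcases le_or_gt n 3780 with hn | hn
  · have h := Chebyshev.theta_le_log4_mul_x (Nat.cast_nonneg (α := ℝ) n)
    have h4 : Real.log 4 ≤ 1.3863 := by
      rw [show (4 : ℝ) = 2 ^ 2 by norm_num, Real.log_pow]
      have := Real.log_two_lt_d9
      norm_num at this ⊢
      linarith
    have hn' : (n : ℝ) ≤ 3780 := by exact_mod_cast hn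
    nlinarith [mul_le_mul_of_nonneg_right h4 (Nat.cast_nonneg (α := ℝ) n)]
  · have hm := ih (n / 42 + 1) (by lia)
    have h1 := theta_mul_le (n / 42 + 1)
    have h2 : Chebyshev.theta n ≤ Chebyshev.theta ((42 * (n / 42 + 1) : ℕ) : ℝ) :=
      Chebyshev.theta_mono (by exact_mod_cast (by lia : n ≤ 42 * (n / 42 + 1)))
    have h3 : (42 : ℝ) * (n / 42 + 1 : ℕ) ≤ n + 42 := by
      exact_mod_cast (by lia : 42 * (n / 42 + 1) ≤ n + 42)
    have hn' : (3780 : ℝ) < n := by exact_mod_cast hn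
    linarith

theorem theta_succ (n : ℕ) : Chebyshev.theta ((n + 1 : ℕ) : ℝ) =
    Chebyshev.theta n + if (n + 1).Prime then Real.log ((n + 1 : ℕ) : ℝ) else 0 := by
  simp only [Chebyshev.theta, Nat.floor_natCast, sum_filter]
  rw [Finset.sum_Ioc_succ_top (by lia)]

theorem primeCounting_succ (n : ℕ) :
    Nat.primeCounting (n + 1) = Nat.primeCounting n + if (n + 1).Prime then 1 else 0 := by
  simp [Nat.primeCounting, Nat.primeCounting', Nat.count_succ]

theorem log_succ_le (n : ℕ) (hn : 0 < n) :
    n * (Real.log ((n + 1 : ℕ) : ℝ) - Real.log n) ≤ 1 := by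
  have h0 : (0 : ℝ) < n := by exact_mod_cast hn
  rw [← Real.log_div (by positivity) h0.ne']
  have := Real.log_le_sub_one_of_pos (x := ((n + 1 : ℕ) : ℝ) / n) (by positivity)
  calc n * Real.log (((n + 1 : ℕ) : ℝ) / n) ≤ n * (((n + 1 : ℕ) : ℝ) / n - 1) := by gcongr
    _ = 1 := by push_cast; field_simp; ring

theorem primeCounting_le_theta_div_log_add (n : ℕ) (hn : 10000 ≤ n) :
    (Nat.primeCounting n : ℝ) ≤
      Chebyshev.theta n / Real.log n + 0.16 * (n / Real.log n) + 5001 := by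
  induction n, hn using Nat.le_induction with
  | base =>
    have h : Nat.primeCounting 10000 ≤ 5001 := by
      have h2 : Nat.primeCounting 2 = 1 := by decide
      have := Nat.primeCounting_add_le (a := 2) (k := 2) (by norm_num) le_rfl 9998
      norm_num [h2] at this
      exact this
    have h' : (Nat.primeCounting 10000 : ℝ) ≤ 5001 := by exact_mod_cast h
    have := Chebyshev.theta_nonneg ((10000 : ℕ) : ℝ)
    have : 0 ≤ Real.log ((10000 : ℕ) : ℝ) := Real.log_natCast_nonneg _
    have : 0 ≤ Chebyshev.theta ((10000 : ℕ) : ℝ) / Real.log ((10000 : ℕ) : ℝ) +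
      0.16 * (((10000 : ℕ) : ℝ) / Real.log ((10000 : ℕ) : ℝ)) := by positivity
    linarith
  | succ n hn ih =>
    have hn' : (10000 : ℝ) ≤ n := by exact_mod_cast hn
    have hx : 9.1 ≤ Real.log n := by
      have h2 : Real.log (2 ^ 13 * (10000 / 2 ^ 13)) ≤ Real.log n :=
        Real.log_le_log (by norm_num) (le_trans (by norm_num) hn')
      rw [Real.log_mul (by norm_num) (by norm_num), Real.log_pow] at h2
      have h3 := Real.one_sub_inv_le_log_of_pos (x := 10000 / 2 ^ 13) (by norm_num)
      have := Real.log_two_gt_d9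
      norm_num at *
      linarith
    have hθ : Chebyshev.theta n ≤ 1.221 * n := by
      have := theta_le_linear n
      linarith
    have hstep := log_succ_le n (by lia)
    have hy : Real.log n ≤ Real.log ((n + 1 : ℕ) : ℝ) :=
      Real.log_le_log (by linarith) (by push_cast; linarith)
    rw [primeCounting_succ, theta_succ]
    set x := Real.log n
    set y := Real.log ((n + 1 : ℕ) : ℝ)
    set t := Chebyshev.theta n
    have hy0 : 0 < y := by linarith
    have hx0 : 0 < x := by linarith
    have key : t / x + 0.16 * (n / x) ≤ t / y + 0.16 * ((n + 1) / y) := by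
      have : 0 ≤ t / y + 0.16 * ((n + 1) / y) - (t / x + 0.16 * (n / x)) := by
        have e : t / y + 0.16 * ((n + 1) / y) - (t / x + 0.16 * (n / x)) =
            (0.16 * x - (t + 0.16 * n) * (y - x)) / (x * y) := by
          field_simp
          ring
        rw [e]
        have h1 : (t + 0.16 * n) * (y - x) ≤ (1.381 * n) * (y - x) :=
          mul_le_mul_of_nonneg_right (by linarith) (by linarith)
        exact div_nonneg (by linarith) (by positivity)
      linarith
    have : (t + if (n + 1).Prime then y else 0) / y = t / y + if (n + 1).Prime then 1 else 0 := by
      split_ifs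
      · field_simp
      · simp
    rw [this]
    push_cast
    linarith

/-- The product of `1 - 1 / p` over the first `k` primes. -/
noncomputable def mertensProd (k : ℕ) : ℝ := ∏ i ∈ range k, (1 - ((Nat.nth Nat.Prime i : ℕ) : ℝ)⁻¹)

/-- The sum of `log p` over the first `k` primes. -/
noncomputable def logPrimeSum (k : ℕ) : ℝ := ∑ i ∈ range k, Real.log (Nat.nth Nat.Prime i : ℕ)

theorem one_sub_inv_nonneg {a : ℕ} : (0 : ℝ) ≤ 1 - (a : ℝ)⁻¹ :=
  sub_nonneg.2 (Nat.cast_inv_le_one a)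

theorem mertensProd_nonneg (k : ℕ) : 0 ≤ mertensProd k :=
  prod_nonneg fun _ _ ↦ one_sub_inv_nonneg

theorem mertensProd_antitone : Antitone mertensProd := by
  refine antitone_nat_of_succ_le fun k ↦ ?_
  rw [mertensProd, prod_range_succ]
  exact mul_le_of_le_one_right (mertensProd_nonneg k) (sub_le_self _ (by positivity))

theorem nth_prime_card_le {s : Finset ℕ} {a : ℕ} (hs : ∀ p ∈ s, p.Prime) (hsa : ∀ p ∈ s, p < a)
    (ha : a.Prime) : Nat.nth Nat.Prime #s ≤ a := by
  have h : #s ≤ Nat.count Nat.Prime a := by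
    rw [Nat.count_eq_card_filter_range]
    exact card_le_card fun p hp ↦ mem_filter.2 ⟨mem_range.2 (hsa p hp), hs p hp⟩
  calc Nat.nth Nat.Prime #s ≤ Nat.nth Nat.Prime (Nat.count Nat.Prime a) :=
        Nat.nth_monotone Nat.infinite_setOfPred_prime h
    _ = a := Nat.nth_count ha

theorem mertensProd_le_and_logPrimeSum_le (s : Finset ℕ) (hs : ∀ p ∈ s, p.Prime) :
    mertensProd #s ≤ ∏ p ∈ s, (1 - (p : ℝ)⁻¹) ∧ logPrimeSum #s ≤ ∑ p ∈ s, Real.log p := by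
  induction s using Finset.induction_on_max with
  | empty => simp [mertensProd, logPrimeSum]
  | insert a s hsa ih =>
    have has : a ∉ s := fun h ↦ (hsa a h).false
    obtain ⟨h1, h2⟩ := ih fun p hp ↦ hs p (mem_insert_of_mem hp)
    have hq : ((Nat.nth Nat.Prime #s : ℕ) : ℝ) ≤ a := by
      exact_mod_cast nth_prime_card_le (fun p hp ↦ hs p (mem_insert_of_mem hp)) hsa
        (hs a (mem_insert_self a s))
    have hq0 : (0 : ℝ) < (Nat.nth Nat.Prime #s : ℕ) := by
      exact_mod_cast (Nat.prime_nth_prime _).pos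
    rw [card_insert_of_notMem has, prod_insert has, sum_insert has, mertensProd, logPrimeSum,
      prod_range_succ, sum_range_succ, mul_comm, add_comm]
    refine ⟨mul_le_mul (by gcongr) h1 (mertensProd_nonneg _) one_sub_inv_nonneg,
      add_le_add (by gcongr) h2⟩

theorem logPrimeSum_le (k : ℕ) :
    logPrimeSum k ≤ ((Nat.nth Nat.Prime k : ℕ) - 1) * Real.log (Nat.nth Nat.Prime k : ℕ) := by
  have hk : (k : ℝ) ≤ (Nat.nth Nat.Prime k : ℕ) - 1 := by
    have : ((k + 2 : ℕ) : ℝ) ≤ (Nat.nth Nat.Prime k : ℕ) := by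
      exact_mod_cast Nat.add_two_le_nth_prime k
    push_cast at this
    linarith
  calc logPrimeSum k ≤ ∑ i ∈ range k, Real.log (Nat.nth Nat.Prime k : ℕ) := by
        refine sum_le_sum fun i hi ↦ Real.log_le_log ?_ ?_
        · exact_mod_cast (Nat.prime_nth_prime _).pos
        · exact_mod_cast Nat.nth_monotone Nat.infinite_setOfPred_prime (mem_range.1 hi).le
    _ = k * Real.log (Nat.nth Nat.Prime k : ℕ) := by simp
    _ ≤ _ := by gcongr

theorem monotone_mertensProd_mul_logPrimeSum :
    Monotone fun k ↦ mertensProd k * logPrimeSum k := by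
  refine monotone_nat_of_le_succ fun k ↦ ?_
  have h := logPrimeSum_le k
  have hq0 : (0 : ℝ) < (Nat.nth Nat.Prime k : ℕ) := by
    exact_mod_cast (Nat.prime_nth_prime _).pos
  have e1 : mertensProd (k + 1) = mertensProd k * (1 - ((Nat.nth Nat.Prime k : ℕ) : ℝ)⁻¹) :=
    prod_range_succ _ _
  have e2 : logPrimeSum (k + 1) = logPrimeSum k + Real.log (Nat.nth Nat.Prime k : ℕ) :=
    sum_range_succ _ _
  simp only [e1, e2, mul_assoc]
  refine mul_le_mul_of_nonneg_left ?_ (mertensProd_nonneg k)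
  have : (1 - ((Nat.nth Nat.Prime k : ℕ) : ℝ)⁻¹) *
      (logPrimeSum k + Real.log (Nat.nth Nat.Prime k : ℕ)) - logPrimeSum k =
      (((Nat.nth Nat.Prime k : ℕ) - 1) * Real.log (Nat.nth Nat.Prime k : ℕ) - logPrimeSum k) /
        (Nat.nth Nat.Prime k : ℕ) := by
    field_simp
    ring
  have := div_nonneg (sub_nonneg.2 h) hq0.le
  linarith

theorem nth_prime_values :
    Nat.nth Nat.Prime 0 = 2 ∧ Nat.nth Nat.Prime 1 = 3 ∧ Nat.nth Nat.Prime 2 = 5 ∧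
    Nat.nth Nat.Prime 3 = 7 ∧ Nat.nth Nat.Prime 4 = 11 ∧ Nat.nth Nat.Prime 5 = 13 ∧
    Nat.nth Nat.Prime 6 = 17 ∧ Nat.nth Nat.Prime 7 = 19 :=
  ⟨Nat.nth_count Nat.prime_two, Nat.nth_count Nat.prime_three, Nat.nth_count Nat.prime_five,
    Nat.nth_count Nat.prime_seven, Nat.nth_count Nat.prime_eleven,
    Nat.nth_count (by norm_num : Nat.Prime 13), Nat.nth_count (by norm_num : Nat.Prime 17),
    Nat.nth_count (by norm_num : Nat.Prime 19)⟩

theorem mertensProd_seven : 0.18052 ≤ mertensProd 7 := by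
  obtain ⟨h0, h1, h2, h3, h4, h5, h6, -⟩ := nth_prime_values
  simp only [mertensProd, prod_range_succ, range_zero, prod_empty, h0, h1, h2, h3, h4, h5, h6]
  norm_num

theorem mertensProd_mul_logPrimeSum_eight : 2.68 ≤ mertensProd 8 * logPrimeSum 8 := by
  obtain ⟨h0, h1, h2, h3, h4, h5, h6, h7⟩ := nth_prime_values
  have hR : 0.171 ≤ mertensProd 8 := by
    simp only [mertensProd, prod_range_succ, range_zero, prod_empty, h0, h1, h2, h3, h4, h5, h6,
      h7]
    norm_num
  have hL : 15.9 ≤ logPrimeSum 8 := by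
    have e : logPrimeSum 8 = Real.log (2 * 3 * 5 * 7 * 11 * 13 * 17 * 19) := by
      simp only [logPrimeSum, sum_range_succ, range_zero, sum_empty, h0, h1, h2, h3, h4, h5, h6,
        h7]
      iterate 7 rw [Real.log_mul (by norm_num) (by norm_num)]
      norm_num
    have h : Real.log (2 ^ 23) ≤ logPrimeSum 8 := e ▸ Real.log_le_log (by norm_num) (by norm_num)
    rw [Real.log_pow] at h
    have := Real.log_two_gt_d9
    norm_num at *
    linarith
  calc (2.68 : ℝ) ≤ 0.171 * 15.9 := by norm_num
    _ ≤ _ := by gcongr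

theorem le_log_of_three_million_le {n : ℕ} (h : 3 * 10 ^ 6 ≤ n) : 14.857 ≤ Real.log n := by
  have hn : (3 * 10 ^ 6 : ℝ) ≤ n := by exact_mod_cast h
  have h2 : Real.log (2 ^ 21 * (3 * 10 ^ 6 / 2 ^ 21)) ≤ Real.log n :=
    Real.log_le_log (by norm_num) (le_trans (by norm_num) hn)
  rw [Real.log_mul (by norm_num) (by norm_num), Real.log_pow] at h2
  have h3 := Real.one_sub_inv_le_log_of_pos (x := 3 * 10 ^ 6 / 2 ^ 21) (by norm_num)
  have := Real.log_two_gt_d9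
  norm_num at *
  linarith

theorem totient_mul_log_ge {n : ℕ} (h : 3 * 10 ^ 6 ≤ n) :
    2.68 * n ≤ Nat.totient n * Real.log n := by
  have hL := le_log_of_three_million_le h
  have hφ : (Nat.totient n : ℝ) = n * ∏ p ∈ n.primeFactors, (1 - (p : ℝ)⁻¹) := by
    have := congrArg (fun q : ℚ ↦ (q : ℝ)) (Nat.totient_eq_mul_prod_factors n)
    push_cast at this
    exact this
  obtain ⟨h1, h2⟩ := mertensProd_le_and_logPrimeSum_le n.primeFactors
    fun p hp ↦ Nat.prime_of_mem_primeFactors hp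
  have hlog : ∑ p ∈ n.primeFactors, Real.log p ≤ Real.log n := by
    rw [← Real.log_prod fun p hp ↦ by
      exact_mod_cast (Nat.prime_of_mem_primeFactors hp).ne_zero]
    refine Real.log_le_log ?_ ?_
    · exact prod_pos fun p hp ↦ by exact_mod_cast (Nat.prime_of_mem_primeFactors hp).pos
    · rw [← Nat.cast_prod]
      exact_mod_cast Nat.le_of_dvd (by lia) (Nat.prod_primeFactors_dvd n)
  have key : 2.68 ≤ mertensProd #n.primeFactors * Real.log n := by
    rcases le_or_gt #n.primeFactors 7 with hk | hk
    · calc (2.68 : ℝ) ≤ 0.18052 * 14.857 := by norm_num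
        _ ≤ _ := mul_le_mul (mertensProd_seven.trans (mertensProd_antitone hk)) hL (by norm_num)
          (mertensProd_nonneg _)
    · calc 2.68 ≤ mertensProd 8 * logPrimeSum 8 := mertensProd_mul_logPrimeSum_eight
        _ ≤ _ := monotone_mertensProd_mul_logPrimeSum hk
        _ ≤ _ := mul_le_mul_of_nonneg_left (h2.trans hlog) (mertensProd_nonneg _)
  rw [hφ, mul_assoc, mul_comm]
  refine mul_le_mul_of_nonneg_left (key.trans ?_) (Nat.cast_nonneg n)
  exact mul_le_mul_of_nonneg_right h1 (by linarith)

theorem log_le_of_linear {n : ℕ} (hn : 0 < n) : Real.log n ≤ 14.25 + n / 2 ^ 22 := by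
  have hn' : (0 : ℝ) < n := by exact_mod_cast hn
  have h := Real.log_le_sub_one_of_pos (x := (n : ℝ) / 2 ^ 22) (by positivity)
  rw [Real.log_div hn'.ne' (by positivity), Real.log_pow] at h
  have := Real.log_two_lt_d9
  norm_num at *
  linarith

theorem primeCounting_mul_log_le {n : ℕ} (h : 3 * 10 ^ 6 ≤ n) :
    Nat.primeCounting n * Real.log n ≤ 1.33 * n := by
  have hL := le_log_of_three_million_le h
  have hL0 : 0 < Real.log n := by linarith
  have hU := log_le_of_linear (n := n) (by lia)
  have hn : (3 * 10 ^ 6 : ℝ) ≤ n := by exact_mod_cast h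
  have hθ := theta_le_linear n
  have hπ := mul_le_mul_of_nonneg_right (primeCounting_le_theta_div_log_add n (by lia)) hL0.le
  have e : (Chebyshev.theta n / Real.log n + 0.16 * (n / Real.log n) + 5001) * Real.log n =
      Chebyshev.theta n + 0.16 * n + 5001 * Real.log n := by
    field_simp
  linarith

/-- For every even integer `n ≥ 3 × 10^6`, `φ(n) - 2 - 2·π(n) > 1000`; in particular
`φ(n) > 2 + 2·π(n)`, where `φ` is Euler's totient and `π` the prime-counting function. -/
theorem stmt_6 (n : ℕ) (hn : Even n) (h : 3 * 10 ^ 6 ≤ n) :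
    ((Nat.totient n : ℤ) - 2 - 2 * (Nat.primeCounting n : ℤ) > 1000) ∧
      Nat.totient n > 2 + 2 * Nat.primeCounting n := by
  have hL := le_log_of_three_million_le h
  have hU := log_le_of_linear (n := n) (by lia)
  have h1 := totient_mul_log_ge h
  have h2 := primeCounting_mul_log_le h
  have hn' : (3 * 10 ^ 6 : ℝ) ≤ n := by exact_mod_cast h
  have key : ((2 * Nat.primeCounting n + 1002 : ℕ) : ℝ) < Nat.totient n := by
    refine lt_of_mul_lt_mul_right ?_ (show 0 ≤ Real.log n by linarith)
    push_cast
    linarith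
  have key' : 2 * Nat.primeCounting n + 1002 < Nat.totient n := by exact_mod_cast key
  lia
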